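/- Let f : ℝ^p → ℝⁿ be continuously differentiable, Y ∈ ℝⁿ, η > 0, and let Θ : [0,∞) → ℝ^p be differentiable with Θ'(t) = −η ∇L(Θ(t)) for all t ≥ 0, where L(Θ) = ½‖f(Θ) − Y‖₂². Write R = ‖f(Θ(0)) − Y‖₂ and let Df(Θ) denote the n × p Jacobian matrix of f at Θ. Suppose there are λ > 0, c ≥ 0 and ρ > 0 such that: (a) vᵀ Df(Θ) Df(Θ)ᵀ v ≥ λ‖v‖₂² for every v ∈ ℝⁿ and every Θ with ‖Θ − Θ(0)‖_∞ ≤ ρ; (b) ‖∂f/∂θᵢ(Θ)‖₂ ≤ c for every such Θ and every i ∈ {1,…,p}; (c) cR/λ ≤ ρ. Then for all t ≥ 0: ‖f(Θ(t)) − Y‖₂ ≤ R e^{−ηλt} and ‖Θ(t) − Θ(0)‖_∞ ≤ (cR/λ)(1 − e^{−ηλt}); in particular ‖Θ(t) − Θ(0)‖_∞ ≤ ρ for all t ≥ 0. -/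

import Mathlib

open Matrix

/-- The Jacobian matrix of `f : ℝ^p → ℝ^n` at `Θ`. -/
noncomputable def jacobian {p n : ℕ}
    (f : EuclideanSpace ℝ (Fin p) → EuclideanSpace ℝ (Fin n))
    (Θ : EuclideanSpace ℝ (Fin p)) : Matrix (Fin n) (Fin p) ℝ :=
  fun i j => fderiv ℝ f Θ (EuclideanSpace.single j 1) i

open Set

/-- A continuous function on `[0, ∞)` that starts at most at `ρ` and cannot reach `ρ` while staying
at most `ρ` remains below `ρ` forever. -/
theorem lt_of_forall_le_imp_lt {D : ℝ → ℝ} {ρ : ℝ} (hD : ContinuousOn D (Ici 0))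
    (h : ∀ T, 0 ≤ T → (∀ s ∈ Icc 0 T, D s ≤ ρ) → D T < ρ) (h0 : D 0 ≤ ρ) {t : ℝ} (ht : 0 ≤ t) :
    D t < ρ := by
  by_contra! hlt
  have hIcc : ∀ T, ContinuousOn D (Icc 0 T) := fun T => hD.mono Icc_subset_Ici_self
  have hcomp : IsCompact (Icc 0 t ∩ D ⁻¹' Ici ρ) :=
    isCompact_Icc.of_isClosed_subset
      ((hIcc t).preimage_isClosed_of_isClosed isClosed_Icc isClosed_Ici) inter_subset_left
  obtain ⟨T, ⟨⟨hT0, hTt⟩, hTρ⟩, hmin⟩ := hcomp.exists_isLeast ⟨t, ⟨ht, le_rfl⟩, hlt⟩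
  obtain ⟨s, ⟨hs0, hsT⟩, hs⟩ := intermediate_value_Icc hT0 (hIcc T) ⟨h0, hTρ⟩
  have hTs : T = s := le_antisymm (hmin ⟨⟨hs0, hsT.trans hTt⟩, hs.ge⟩) hsT
  refine absurd (h T hT0 fun x hx => ?_) (not_lt.2 hTρ)
  by_contra! hx'
  have hxT : x = T := le_antisymm hx.2 (hmin ⟨⟨hx.1, hx.2.trans hTt⟩, hx'.le⟩)
  rw [hxT, hTs, hs] at hx'
  exact lt_irrefl _ hx'

/-- The gradient of the squared loss `½‖f − Y‖²` is the adjoint derivative of `f` applied to the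
residual. -/
theorem hasGradientAt_half_norm_sub_sq {E F : Type*} [NormedAddCommGroup E]
    [InnerProductSpace ℝ E] [CompleteSpace E] [NormedAddCommGroup F] [InnerProductSpace ℝ F]
    [CompleteSpace F] {f : E → F} {x : E} (hf : DifferentiableAt ℝ f x) (Y : F) :
    HasGradientAt (fun z => (1 / 2) * ‖f z - Y‖ ^ 2)
      ((fderiv ℝ f x).adjoint (f x - Y)) x := by
  rw [hasGradientAt_iff_hasFDerivAt]
  refine ((hf.hasFDerivAt.sub_const Y).norm_sq.const_mul (1 / 2 : ℝ)).congr_fderiv ?_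
  ext v
  simp [ContinuousLinearMap.adjoint_inner_left]

section Jacobian

variable {p n : ℕ} (f : EuclideanSpace ℝ (Fin p) → EuclideanSpace ℝ (Fin n))
  (x : EuclideanSpace ℝ (Fin p)) (v : EuclideanSpace ℝ (Fin n))

theorem adjoint_fderiv_apply (j : Fin p) :
    (fderiv ℝ f x).adjoint v j = inner ℝ (fderiv ℝ f x (EuclideanSpace.single j 1)) v := by
  rw [← ContinuousLinearMap.adjoint_inner_right, EuclideanSpace.inner_single_left]
  simp

theorem adjoint_fderiv_apply_eq_mulVec (j : Fin p) :
    (fderiv ℝ f x).adjoint v j = ((jacobian f x)ᵀ *ᵥ fun i => v i) j := by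
  rw [adjoint_fderiv_apply]
  simp [PiLp.inner_apply, mulVec, dotProduct, jacobian, mul_comm]

theorem dotProduct_jacobian_mul_transpose_mulVec :
    (fun i => v i) ⬝ᵥ ((jacobian f x * (jacobian f x)ᵀ) *ᵥ fun i => v i) =
      ‖(fderiv ℝ f x).adjoint v‖ ^ 2 := by
  rw [← mulVec_mulVec, dotProduct_mulVec, ← mulVec_transpose, EuclideanSpace.real_norm_sq_eq]
  simp only [adjoint_fderiv_apply_eq_mulVec, dotProduct, sq]

theorem abs_adjoint_fderiv_apply_le (j : Fin p) :
    |(fderiv ℝ f x).adjoint v j| ≤ Real.sqrt (∑ k, (jacobian f x k j) ^ 2) * ‖v‖ := by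
  rw [adjoint_fderiv_apply]
  refine (abs_real_inner_le_norm _ _).trans_eq ?_
  rw [EuclideanSpace.norm_eq (fderiv ℝ f x _)]
  simp [jacobian]

end Jacobian

/-- If the derivative of `u = ‖r‖²` is at most `-2 a u` on `[0, T]`, then `‖r‖` decays at rate
`a`. -/
theorem norm_le_mul_exp_of_hasDerivAt_norm_sq {F : Type*} [NormedAddCommGroup F] {r : ℝ → F}
    {u' : ℝ → ℝ} {a T : ℝ} (hT : 0 ≤ T)
    (hu : ∀ t ∈ Icc 0 T, HasDerivAt (fun s => ‖r s‖ ^ 2) (u' t) t)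
    (hu' : ∀ t ∈ Icc 0 T, u' t ≤ -(2 * a) * ‖r t‖ ^ 2) :
    ‖r T‖ ≤ ‖r 0‖ * Real.exp (-a * T) := by
  have hd : ∀ t ∈ Icc 0 T, HasDerivAt (fun s => ‖r s‖ ^ 2 * Real.exp (2 * a * s))
      (u' t * Real.exp (2 * a * t) + ‖r t‖ ^ 2 * (Real.exp (2 * a * t) * (2 * a))) t := by
    intro t ht
    have he : HasDerivAt (fun s => Real.exp (2 * a * s)) (Real.exp (2 * a * t) * (2 * a)) t := by
      simpa using ((hasDerivAt_id t).const_mul (2 * a)).exp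
    exact (hu t ht).mul he
  have hanti : AntitoneOn (fun s => ‖r s‖ ^ 2 * Real.exp (2 * a * s)) (Icc 0 T) := by
    refine antitoneOn_of_deriv_nonpos (convex_Icc 0 T)
      (fun t ht => (hd t ht).continuousAt.continuousWithinAt)
      (fun t ht => (hd t (interior_subset ht)).differentiableAt.differentiableWithinAt) ?_
    intro t ht
    rw [(hd t (interior_subset ht)).deriv]
    nlinarith [mul_le_mul_of_nonneg_right (hu' t (interior_subset ht))
      (Real.exp_pos (2 * a * t)).le]
  have hle := hanti ⟨le_rfl, hT⟩ ⟨hT, le_rfl⟩ hT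
  simp only [mul_zero, Real.exp_zero, mul_one] at hle
  have hexp : Real.exp (2 * a * T) = Real.exp (a * T) ^ 2 := by
    rw [← Real.exp_nat_mul]; push_cast; ring_nf
  rw [hexp, ← mul_pow] at hle
  have hle' := le_of_sq_le_sq hle (norm_nonneg _)
  rwa [neg_mul, Real.exp_neg, ← div_eq_mul_inv, le_div_iff₀ (Real.exp_pos _)]

/-- **Deterministic lazy-training bootstrap.** Along the gradient flow for
`L(Θ) = ½‖f(Θ) − Y‖²`, if the empirical kernel `Df Dfᵀ` is bounded below by `λ` and the
gradient columns are bounded by `c` on the `ℓ^∞`-ball of radius `ρ` around `Θ(0)`, and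
`cR/λ ≤ ρ`, then the loss decays exponentially and every parameter stays within
`(cR/λ)(1 − e^{−ηλt}) ≤ ρ` of its initialization. -/
theorem lazy_training_bootstrap {p n : ℕ}
    (f : EuclideanSpace ℝ (Fin p) → EuclideanSpace ℝ (Fin n)) (hf : ContDiff ℝ 1 f)
    (Y : EuclideanSpace ℝ (Fin n)) (η : ℝ) (hη : 0 < η)
    (L : EuclideanSpace ℝ (Fin p) → ℝ)
    (hLdef : L = fun Θ => (1 / 2) * ‖f Θ - Y‖ ^ 2)
    (Θ : ℝ → EuclideanSpace ℝ (Fin p))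
    (hΘ : ∀ t, 0 ≤ t → HasDerivAt Θ (-η • gradient L (Θ t)) t)
    (R : ℝ) (hR : R = ‖f (Θ 0) - Y‖)
    (lam c ρ : ℝ) (hlam : 0 < lam) (hc : 0 ≤ c) (hρ : 0 < ρ)
    (hkernel : ∀ (v : EuclideanSpace ℝ (Fin n)) (Θ' : EuclideanSpace ℝ (Fin p)),
      (∀ j, |Θ' j - Θ 0 j| ≤ ρ) →
      lam * ‖v‖ ^ 2 ≤ (fun i => v i) ⬝ᵥ ((jacobian f Θ' * (jacobian f Θ')ᵀ) *ᵥ fun i => v i))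
    (hcols : ∀ Θ' : EuclideanSpace ℝ (Fin p), (∀ j, |Θ' j - Θ 0 j| ≤ ρ) →
      ∀ i, Real.sqrt (∑ k, (jacobian f Θ' k i) ^ 2) ≤ c)
    (hcr : c * R / lam ≤ ρ) :
    ∀ t, 0 ≤ t →
      ‖f (Θ t) - Y‖ ≤ R * Real.exp (-η * lam * t) ∧
      (∀ j, |Θ t j - Θ 0 j| ≤ (c * R / lam) * (1 - Real.exp (-η * lam * t))) ∧
      (∀ j, |Θ t j - Θ 0 j| ≤ ρ) := by
  subst hR
  set R := ‖f (Θ 0) - Y‖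
  have hR0 : 0 ≤ R := norm_nonneg _
  have hdf : Differentiable ℝ f := hf.differentiable one_ne_zero
  set A := fun t => (fderiv ℝ f (Θ t)).adjoint (f (Θ t) - Y)
  have hΘ' : ∀ t, 0 ≤ t → HasDerivAt Θ (-η • A t) t := by
    intro t ht
    have h := hΘ t ht
    rwa [hLdef, (hasGradientAt_half_norm_sub_sq (hdf (Θ t)) Y).gradient] at h
  have hloss : ∀ t, 0 ≤ t →
      HasDerivAt (fun s => ‖f (Θ s) - Y‖ ^ 2) (-(2 * η) * ‖A t‖ ^ 2) t := by
    intro t ht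
    have h := (((hdf (Θ t)).hasFDerivAt.comp_hasDerivAt t (hΘ' t ht)).sub_const Y).norm_sq
    refine h.congr_deriv ?_
    rw [← ContinuousLinearMap.adjoint_inner_left]
    change 2 * inner ℝ (A t) (-η • A t) = _
    rw [inner_smul_right, real_inner_self_eq_norm_sq]
    ring
  have hdecay : ∀ T, 0 ≤ T → (∀ s ∈ Icc 0 T, ∀ j, |Θ s j - Θ 0 j| ≤ ρ) →
      ‖f (Θ T) - Y‖ ≤ R * Real.exp (-η * lam * T) := by
    intro T hT hball
    have h := norm_le_mul_exp_of_hasDerivAt_norm_sq (r := fun s => f (Θ s) - Y) (a := η * lam) hT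
      (fun t ht => hloss t ht.1) fun t ht => by
        have hk := hkernel (f (Θ t) - Y) (Θ t) (hball t ht)
        rw [dotProduct_jacobian_mul_transpose_mulVec] at hk
        nlinarith [mul_le_mul_of_nonneg_left hk hη.le]
    rwa [← neg_mul] at h
  have hdist : ∀ T, 0 ≤ T → (∀ s ∈ Icc 0 T, ∀ j, |Θ s j - Θ 0 j| ≤ ρ) →
      ∀ j, |Θ T j - Θ 0 j| ≤ (c * R / lam) * (1 - Real.exp (-η * lam * T)) := by
    intro T hT hball j
    have hcoord : ∀ t, 0 ≤ t → HasDerivAt (fun s => Θ s j - Θ 0 j) (-η * A t j) t := by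
      intro t ht
      exact ((EuclideanSpace.proj (𝕜 := ℝ) j).hasFDerivAt.comp_hasDerivAt t
        (hΘ' t ht)).sub_const (Θ 0 j)
    have hbound : ∀ t, HasDerivAt (fun s => (c * R / lam) * (1 - Real.exp (-η * lam * s)))
        (η * (c * (R * Real.exp (-η * lam * t)))) t := by
      intro t
      refine ((((hasDerivAt_id t).const_mul (-η * lam)).exp.const_sub 1).const_mul
        (c * R / lam)).congr_deriv ?_
      simp only [id]
      field_simp
    refine image_norm_le_of_norm_deriv_right_le_deriv_boundary
      (f := fun s => Θ s j - Θ 0 j) (f' := fun t => -η * A t j)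
      (fun t ht => (hcoord t ht.1).continuousAt.continuousWithinAt)
      (fun t ht => (hcoord t ht.1).hasDerivWithinAt) (by simp) hbound ?_ ⟨hT, le_rfl⟩
    intro t ht
    rw [norm_mul, norm_neg, Real.norm_of_nonneg hη.le]
    refine mul_le_mul_of_nonneg_left ?_ hη.le
    have hin : ∀ s ∈ Icc 0 t, ∀ j, |Θ s j - Θ 0 j| ≤ ρ :=
      fun s hs => hball s ⟨hs.1, hs.2.trans ht.2.le⟩
    refine (abs_adjoint_fderiv_apply_le f (Θ t) _ j).trans ?_
    exact mul_le_mul (hcols _ (hin t ⟨ht.1, le_rfl⟩) j) (hdecay t ht.1 hin) (norm_nonneg _) hc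
  have hstrict : ∀ T, (c * R / lam) * (1 - Real.exp (-η * lam * T)) < ρ := by
    intro T
    have hM : 0 ≤ c * R / lam := by positivity
    rcases hM.eq_or_lt with h | h
    · rwa [← h, zero_mul]
    · nlinarith [mul_pos h (Real.exp_pos (-η * lam * T))]
  have hiff : ∀ s, ‖WithLp.ofLp (Θ s - Θ 0)‖ ≤ ρ ↔ ∀ j, |Θ s j - Θ 0 j| ≤ ρ := fun s => by
    simp [pi_norm_le_iff_of_nonneg hρ.le]
  have hball : ∀ t, 0 ≤ t → ∀ j, |Θ t j - Θ 0 j| ≤ ρ := by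
    intro t ht
    refine (hiff t).1 (lt_of_forall_le_imp_lt (D := fun s => ‖WithLp.ofLp (Θ s - Θ 0)‖)
      ?_ ?_ ?_ ht).le
    · have hcont : ContinuousOn Θ (Ici 0) :=
        fun s hs => (hΘ s hs).continuousAt.continuousWithinAt
      exact ((PiLp.continuous_ofLp 2 _).comp_continuousOn (hcont.sub continuousOn_const)).norm
    · intro T hT h
      rw [pi_norm_lt_iff hρ]
      exact fun j => (hdist T hT (fun s hs => (hiff s).1 (h s hs)) j).trans_lt (hstrict T)
    · simpa using hρ.le
  exact fun t ht => ⟨hdecay t ht fun s hs => hball s hs.1,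
    hdist t ht fun s hs => hball s hs.1, hball t ht⟩
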